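/- The set Z²(G,kˣ) is a group under the sharp product: ♯ is associative, the trivial cocycle (constantly 1) is a two-sided identity, and the ♯-inverse of σ is the map σ'(g,h) = σ(g,h)⁻¹(−1)^{|g|_σ|h|_σ}, which is again a 2-cocycle and satisfies σ♯σ' = σ'♯σ = trivial cocycle. -/

import Mathlib

variable (k : Type*) [Field k] (G : Type*) [Group G]

/-- A normalized 2-cocycle on `G` with values in `kˣ` (trivial `G`-action):
`σ(g,h)σ(gh,l) = σ(h,l)σ(g,hl)` and `σ(1,g) = σ(g,1) = 1`. -/
def IsCocycle (σ : G → G → kˣ) : Prop :=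
  (∀ g h l : G, σ g h * σ (g * h) l = σ h l * σ g (h * l)) ∧
    (∀ g : G, σ 1 g = 1) ∧ (∀ g : G, σ g 1 = 1)

open Classical in
/-- The degree `|g|_σ ∈ {0,1}` determined by `θ(σ)(g) = σ(g,u)σ(u,g)⁻¹ = (-1)^{|g|_σ}`. -/
noncomputable def deg (u : G) (σ : G → G → kˣ) (g : G) : ℕ :=
  if σ g u = σ u g then 0 else 1

/-- The sharp product `(σ♯ω)(g,h) = σ(g,h)ω(g,h)(-1)^{|g|_σ |h|_ω}`. -/
noncomputable def sharpFun (u : G) (σ ω : G → G → kˣ) : G → G → kˣ :=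
  fun g h => σ g h * ω g h * (-1 : kˣ) ^ (deg k G u σ g * deg k G u ω h)

/-- The candidate ♯-inverse `σ'(g,h) = σ(g,h)⁻¹ (-1)^{|g|_σ |h|_σ}`. -/
noncomputable def sharpInvFun (u : G) (σ : G → G → kˣ) : G → G → kˣ :=
  fun g h => (σ g h)⁻¹ * (-1 : kˣ) ^ (deg k G u σ g * deg k G u σ h)

section helpers

theorem deg_self (u : G) (σ : G → G → kˣ) : deg k G u σ u = 0 := by simp [deg]

theorem sign_deg (u : G) (σ : G → G → kˣ) (g : G) (e : kˣ) (h : σ g u = σ u g * e)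
    (he : e = 1 ∨ e = -1) : (-1 : kˣ) ^ deg k G u σ g = e := by
  unfold deg
  split_ifs with h1
  · rw [h1] at h
    simpa [eq_comm] using h
  · rcases he with rfl | rfl
    · exact absurd (by simpa using h) h1
    · simp

theorem theta_sq (u : G) (hcen : ∀ g : G, u * g = g * u) (hu : u ^ 2 = 1) (σ : G → G → kˣ)
    (hσ : IsCocycle k G σ) (g : G) : σ g u * σ g u = σ u g * σ u g := by
  obtain ⟨hc, h1, h2⟩ := hσ
  have huu : u * u = 1 := by rw [← pow_two, hu]
  have a := hc g u u
  have b := hc u u g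
  have c := hc u g u
  rw [huu, h2, mul_one] at a
  rw [huu, h1, mul_one, hcen g] at b
  rw [hcen g] at c
  have hab : σ g u * σ (g * u) u = σ u g * σ u (g * u) := by
    rw [a, b]
  have : (σ g u * σ g u) * σ u (g * u) = (σ u g * σ u g) * σ u (g * u) := by
    calc _ = σ g u * (σ g u * σ u (g * u)) := by rw [mul_assoc]
      _ = σ u g * (σ g u * σ (g * u) u) := by rw [← c, mul_left_comm]
      _ = _ := by rw [hab, mul_assoc]
  exact mul_right_cancel this

theorem theta_eq (u : G) (hcen : ∀ g : G, u * g = g * u) (hu : u ^ 2 = 1) (σ : G → G → kˣ)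
    (hσ : IsCocycle k G σ) (g : G) : σ g u = σ u g * (-1 : kˣ) ^ deg k G u σ g := by
  have h := congrArg Units.val (theta_sq k G u hcen hu σ hσ g)
  simp only [Units.val_mul] at h
  unfold deg
  split_ifs with h1
  · simpa using h1
  · rcases mul_self_eq_mul_self_iff.1 h with h | h
    · exact absurd (Units.ext h) h1
    · apply Units.ext
      simpa using h

theorem sign_or (n : ℕ) : (-1 : kˣ) ^ n = 1 ∨ (-1 : kˣ) ^ n = -1 := neg_one_pow_eq_or _ n

theorem sign_sq (n : ℕ) : (-1 : kˣ) ^ n * (-1 : kˣ) ^ n = 1 := by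
  rw [← mul_pow]; simp

theorem sign_deg_mul (u : G) (hcen : ∀ g : G, u * g = g * u) (hu : u ^ 2 = 1) (σ : G → G → kˣ)
    (hσ : IsCocycle k G σ) (g h : G) :
    (-1 : kˣ) ^ deg k G u σ (g * h) = (-1) ^ deg k G u σ g * (-1) ^ deg k G u σ h := by
  apply sign_deg
  · have tg := theta_eq k G u hcen hu σ hσ g
    have th := theta_eq k G u hcen hu σ hσ h
    generalize (-1 : kˣ) ^ deg k G u σ g = x at *
    generalize (-1 : kˣ) ^ deg k G u σ h = y at *
    have a := hσ.1 g h u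
    have b := hσ.1 g u h
    have c := hσ.1 u g h
    rw [hcen h] at b
    rw [hcen g] at c
    rw [th] at a
    rw [tg] at b
    have e1 : σ g h * σ (g * h) u = σ g h * (σ u (g * h) * (x * y)) := by
      calc _ = (σ u h * σ g (h * u)) * y := by rw [a]; exact mul_right_comm _ _ _
        _ = (σ u g * σ (g * u) h) * x * y := by rw [← b]; congr 1; exact mul_right_comm _ _ _
        _ = _ := by rw [c]; simp only [mul_assoc]
    exact mul_left_cancel e1
  · rw [← pow_add]
    exact sign_or k _

theorem sign_sharp (u : G) (hcen : ∀ g : G, u * g = g * u) (hu : u ^ 2 = 1)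
    (σ ω : G → G → kˣ) (hσ : IsCocycle k G σ) (hω : IsCocycle k G ω) (g : G) :
    (-1 : kˣ) ^ deg k G u (sharpFun k G u σ ω) g
      = (-1) ^ deg k G u σ g * (-1) ^ deg k G u ω g := by
  apply sign_deg
  · simp only [sharpFun, deg_self, mul_zero, zero_mul, pow_zero, mul_one]
    rw [theta_eq k G u hcen hu σ hσ g, theta_eq k G u hcen hu ω hω g]
    exact mul_mul_mul_comm _ _ _ _
  · rw [← pow_add]
    exact sign_or k _

theorem deg_inv (u : G) (σ : G → G → kˣ) (g : G) :
    deg k G u (sharpInvFun k G u σ) g = deg k G u σ g := by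
  have e : sharpInvFun k G u σ g u = sharpInvFun k G u σ u g ↔ σ g u = σ u g := by
    simp only [sharpInvFun, deg_self, mul_zero, zero_mul, pow_zero, mul_one, inv_inj]
  unfold deg
  by_cases h : σ g u = σ u g
  · rw [if_pos h, if_pos (e.2 h)]
  · rw [if_neg h, if_neg (fun h' => h (e.1 h'))]

theorem sign_bichar_left (u : G) (hcen : ∀ g : G, u * g = g * u) (hu : u ^ 2 = 1)
    (σ : G → G → kˣ) (hσ : IsCocycle k G σ) (g h : G) (n : ℕ) :
    (-1 : kˣ) ^ (deg k G u σ (g * h) * n)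
      = (-1) ^ (deg k G u σ g * n) * (-1) ^ (deg k G u σ h * n) := by
  rw [pow_mul, sign_deg_mul k G u hcen hu σ hσ, mul_pow, ← pow_mul, ← pow_mul]

theorem sign_bichar_right (u : G) (hcen : ∀ g : G, u * g = g * u) (hu : u ^ 2 = 1)
    (σ : G → G → kˣ) (hσ : IsCocycle k G σ) (g h : G) (n : ℕ) :
    (-1 : kˣ) ^ (n * deg k G u σ (g * h))
      = (-1) ^ (n * deg k G u σ g) * (-1) ^ (n * deg k G u σ h) := by
  simp only [mul_comm n]
  exact sign_bichar_left k G u hcen hu σ hσ g h n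

theorem deg_one (u : G) (σ : G → G → kˣ) (hσ : IsCocycle k G σ) : deg k G u σ 1 = 0 := by
  simp [deg, hσ.2.1, hσ.2.2]

/-- Closure under the sharp product (not part of the frozen statement). -/
theorem sharp_isCocycle (u : G) (hcen : ∀ g : G, u * g = g * u) (hu : u ^ 2 = 1)
    (σ ω : G → G → kˣ) (hσ : IsCocycle k G σ) (hω : IsCocycle k G ω) :
    IsCocycle k G (sharpFun k G u σ ω) := by
  refine ⟨fun g h l => ?_, fun g => ?_, fun g => ?_⟩
  · simp only [sharpFun]
    rw [sign_bichar_left k G u hcen hu σ hσ, sign_bichar_right k G u hcen hu ω hω]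
    have a := hσ.1 g h l
    have b := hω.1 g h l
    rw [mul_mul_mul_comm, mul_mul_mul_comm (σ g h), a, b, mul_mul_mul_comm (σ h l * ω h l),
      mul_mul_mul_comm (σ h l)]
    congr 1
    simp only [mul_assoc, mul_comm, mul_left_comm]
  · simp [sharpFun, deg_one k G u σ hσ, hσ.2.1, hω.2.1]
  · simp [sharpFun, deg_one k G u ω hω, hσ.2.2, hω.2.2]

theorem inv_isCocycle (u : G) (hcen : ∀ g : G, u * g = g * u) (hu : u ^ 2 = 1)
    (σ : G → G → kˣ) (hσ : IsCocycle k G σ) :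
    IsCocycle k G (sharpInvFun k G u σ) := by
  refine ⟨fun g h l => ?_, fun g => ?_, fun g => ?_⟩
  · simp only [sharpInvFun]
    rw [sign_bichar_left k G u hcen hu σ hσ, sign_bichar_right k G u hcen hu σ hσ]
    have a := hσ.1 g h l
    rw [mul_mul_mul_comm, ← mul_inv, a, mul_mul_mul_comm (σ h l)⁻¹, ← mul_inv]
    congr 1
    simp only [mul_assoc, mul_comm, mul_left_comm]
  · simp [sharpInvFun, deg_one k G u σ hσ, hσ.2.1]
  · simp [sharpInvFun, deg_one k G u σ hσ, hσ.2.2]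

end helpers

/-- `Z²(G,kˣ)` is a group under the sharp product: `♯` is associative, the trivial
cocycle is a two-sided identity, and `σ'(g,h) = σ(g,h)⁻¹(-1)^{|g|_σ|h|_σ}` is a
2-cocycle which is a two-sided ♯-inverse of `σ`. -/
theorem statement2 [Finite G] (u : G) (hcen : ∀ g : G, u * g = g * u) (hu : u ^ 2 = 1) :
    (∀ σ ω β : G → G → kˣ, IsCocycle k G σ → IsCocycle k G ω → IsCocycle k G β →
        sharpFun k G u (sharpFun k G u σ ω) β = sharpFun k G u σ (sharpFun k G u ω β)) ∧
    (∀ σ : G → G → kˣ, IsCocycle k G σ →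
        sharpFun k G u σ (fun _ _ => 1) = σ ∧ sharpFun k G u (fun _ _ => 1) σ = σ) ∧
    (∀ σ : G → G → kˣ, IsCocycle k G σ →
        IsCocycle k G (sharpInvFun k G u σ) ∧
        sharpFun k G u σ (sharpInvFun k G u σ) = (fun _ _ => 1) ∧
        sharpFun k G u (sharpInvFun k G u σ) σ = (fun _ _ => 1)) := by
  refine ⟨fun σ ω β hσ hω hβ => ?_, fun σ hσ => ⟨?_, ?_⟩, fun σ hσ => ⟨?_, ?_, ?_⟩⟩
  · funext g h
    have e1 : (-1 : kˣ) ^ (deg k G u (sharpFun k G u σ ω) g * deg k G u β h)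
        = (-1) ^ (deg k G u σ g * deg k G u β h) * (-1) ^ (deg k G u ω g * deg k G u β h) := by
      rw [pow_mul, sign_sharp k G u hcen hu σ ω hσ hω, mul_pow, ← pow_mul, ← pow_mul]
    have e2 : (-1 : kˣ) ^ (deg k G u σ g * deg k G u (sharpFun k G u ω β) h)
        = (-1) ^ (deg k G u σ g * deg k G u ω h) * (-1) ^ (deg k G u σ g * deg k G u β h) := by
      rw [pow_mul', sign_sharp k G u hcen hu ω β hω hβ, mul_pow, ← pow_mul', ← pow_mul']
    change sharpFun k G u σ ω g h * β g h * _ = σ g h * sharpFun k G u ω β g h * _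
    rw [e1, e2]
    simp only [sharpFun]
    simp only [mul_assoc, mul_comm, mul_left_comm]
  · funext g h
    simp [sharpFun, deg]
  · funext g h
    simp [sharpFun, deg]
  · exact inv_isCocycle k G u hcen hu σ hσ
  · funext g h
    simp only [sharpFun, deg_inv]
    simp only [sharpInvFun]
    rw [mul_inv_cancel_left]
    exact sign_sq k _
  · funext g h
    simp only [sharpFun, deg_inv]
    simp only [sharpInvFun]
    rw [mul_right_comm (σ g h)⁻¹, inv_mul_cancel, one_mul]
    exact sign_sq k _
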